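/- Let n ≥ 1 and let 𝒯 = {K_1, …, K_q} be a triangle patch around a point z ∈ ℝ², with inner product (u,v)_𝒯 := Σ_{i=1}^q (u,v)_{K_i}. If u is a real bivariate polynomial of total degree ≤ n such that (u,w)_𝒯 = 0 for every piecewise polynomial w on the patch satisfying w|_{K_i} ∈ P_{n−1}(K_i) for every i, then u = 0 on Ω. -/

import Mathlib

open MeasureTheory Finset

noncomputable section

/-- 2×2 determinant of two vectors in `ℝ²`. -/
def det2 (u v : ℝ × ℝ) : ℝ := u.1 * v.2 - u.2 * v.1

/-- The open triangle with vertices `A`, `B`, `C` (interior of the convex hull). -/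
def tri (A B C : ℝ × ℝ) : Set (ℝ × ℝ) := interior (convexHull ℝ {A, B, C})

/-- Barycentric coordinate of `p` with respect to the vertex `A` of triangle `ABC`. -/
def bary (A B C p : ℝ × ℝ) : ℝ := det2 (p - B) (C - B) / det2 (A - B) (C - B)

/-- The cubic bubble: product of the three barycentric coordinates of triangle `ABC`. -/
def bubble (A B C p : ℝ × ℝ) : ℝ := bary A B C p * bary B C A p * bary C A B p

/-- Evaluation of a bivariate polynomial at a point of `ℝ²`. -/
def evalP (u : MvPolynomial (Fin 2) ℝ) (p : ℝ × ℝ) : ℝ :=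
  MvPolynomial.eval ![p.1, p.2] u

/-- The inner product `(u,v)_K := ∫_K u v ω_K` on the open triangle `K = conv°(A,B,C)`,
with weight the product of the barycentric coordinates. -/
def innerT (A B C : ℝ × ℝ) (u v : MvPolynomial (Fin 2) ℝ) : ℝ :=
  ∫ p in tri A B C, evalP u p * evalP v p * bubble A B C p

/-- `u ∈ P_{n-1}^⊥(K)` for `K = conv°(A,B,C)`: `u` has total degree at most `n` and is
orthogonal to every polynomial of total degree at most `n-1` w.r.t. `(·,·)_K`. -/
def inPerp (n : ℕ) (A B C : ℝ × ℝ) (u : MvPolynomial (Fin 2) ℝ) : Prop :=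
  u.totalDegree ≤ n ∧
    ∀ w : MvPolynomial (Fin 2) ℝ, w.totalDegree ≤ n - 1 → innerT A B C u w = 0

/-- A triangle patch around a point `z`: `q ≥ 3` pairwise disjoint nondegenerate open
triangles `K_i = conv°(z, A_{i-1}, A_i)` (indices cyclic, i.e. in `ZMod q`), consecutive ones
sharing the edge from `z` to `A_i`, whose closed union covers a neighbourhood of `z`. -/
structure TrianglePatch (q : ℕ) where
  hq : 3 ≤ q
  z : ℝ × ℝ
  A : ZMod q → ℝ × ℝ
  indep : ∀ i : ZMod q, AffineIndependent ℝ ![z, A (i - 1), A i]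
  disj : Pairwise fun i j : ZMod q =>
    Disjoint (tri z (A (i - 1)) (A i)) (tri z (A (j - 1)) (A j))
  covers : ∃ ε > 0, Metric.ball z ε ⊆ ⋃ i : ZMod q, closure (tri z (A (i - 1)) (A i))

/-- The `i`-th triangle of a patch. -/
def TrianglePatch.K {q : ℕ} (T : TrianglePatch q) (i : ZMod q) : Set (ℝ × ℝ) :=
  tri T.z (T.A (i - 1)) (T.A i)

/-- `Ω`: the interior of the union of the closed triangles of the patch. -/
def TrianglePatch.Omega {q : ℕ} (T : TrianglePatch q) : Set (ℝ × ℝ) :=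
  interior (⋃ i : ZMod q, closure (tri T.z (T.A (i - 1)) (T.A i)))

/-- The patch inner product `(u,v)_𝒯 = Σ_i (u_i, v_i)_{K_i}` of two piecewise polynomials
(given as tuples of polynomials, one for each triangle). -/
def patchInner {q : ℕ} (T : TrianglePatch q)
    (u v : ZMod q → MvPolynomial (Fin 2) ℝ) : ℝ :=
  haveI : NeZero q := ⟨by have := T.hq; omega⟩
  ∑ i : ZMod q, innerT T.z (T.A (i - 1)) (T.A i) (u i) (v i)


open Polynomial in
/-- Integration of real polynomials over the unit interval, as a linear functional. -/
def unitIntegral : ℝ[X] →ₗ[ℝ] ℝ where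
  toFun F := ∫ x in (0 : ℝ)..1, F.eval x
  map_add' F G := by
    simp only [Polynomial.eval_add]
    exact intervalIntegral.integral_add (F.continuous.intervalIntegrable _ _)
      (G.continuous.intervalIntegrable _ _)
  map_smul' c F := by
    simp [Polynomial.eval_smul]

open Polynomial in
lemma unitIntegral_apply (F : ℝ[X]) : unitIntegral F = ∫ x in (0 : ℝ)..1, F.eval x := rfl

section UnivariatePolynomials

open Polynomial

lemma eq_zero_of_forall_mem_Ioo_eval_eq_zero {F : ℝ[X]}
    (h : ∀ x ∈ Set.Ioo (0 : ℝ) 1, F.eval x = 0) : F = 0 :=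
  F.eq_zero_of_infinite_isRoot ((Set.Ioo_infinite zero_lt_one).mono h)

lemma eq_zero_of_unitIntegral_eq_zero {F : ℝ[X]}
    (hF : ∀ x ∈ Set.Ioo (0 : ℝ) 1, 0 ≤ F.eval x) (h : unitIntegral F = 0) : F = 0 := by
  refine eq_zero_of_forall_mem_Ioo_eval_eq_zero fun x hx => ?_
  by_contra hne
  have hnonneg : ∀ y ∈ Set.Icc (0 : ℝ) 1, 0 ≤ F.eval y := by
    have hsub : closure (Set.Ioo (0 : ℝ) 1) ⊆ {y | 0 ≤ F.eval y} :=
      closure_minimal hF (isClosed_le continuous_const F.continuous)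
    rwa [closure_Ioo zero_ne_one] at hsub
  have hpos := intervalIntegral.integral_pos zero_lt_one F.continuous.continuousOn
    (fun y hy => hnonneg y ⟨hy.1.le, hy.2⟩)
    ⟨x, ⟨hx.1.le, hx.2.le⟩, lt_of_le_of_ne (hF x hx) (Ne.symm hne)⟩
  rw [← unitIntegral_apply, h] at hpos
  exact lt_irrefl _ hpos

/-- The sign changes of a polynomial on the unit interval can be cancelled by simple factors at
some of its roots. -/
lemma exists_roots_mul_prod_sign (f : ℝ[X]) (hf : f ≠ 0) :
    ∃ S : Finset ℝ, (∀ r ∈ S, r ∈ Set.Ioo (0 : ℝ) 1 ∧ f.eval r = 0) ∧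
      ∃ ε : ℝ, ε ≠ 0 ∧
        ∀ x ∈ Set.Ioo (0 : ℝ) 1, 0 ≤ ε * (f * ∏ r ∈ S, (X - C r)).eval x := by
  induction hd : f.natDegree generalizing f with
  | zero =>
    obtain ⟨c, rfl⟩ := natDegree_eq_zero.1 hd
    have hc : c ≠ 0 := by simpa using hf
    exact ⟨∅, by simp, c, hc, fun x _ => by simpa using mul_self_nonneg c⟩
  | succ d ih =>
    by_cases hroot : ∃ r ∈ Set.Ioo (0 : ℝ) 1, f.eval r = 0
    · obtain ⟨r, hr, hfr⟩ := hroot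
      obtain ⟨g, rfl⟩ := dvd_iff_isRoot.2 hfr
      have hg : g ≠ 0 := right_ne_zero_of_mul hf
      have hgd : g.natDegree = d := by
        rw [natDegree_mul (X_sub_C_ne_zero r) hg, natDegree_X_sub_C] at hd
        omega
      obtain ⟨S, hS, ε, hε, hsign⟩ := ih g hg hgd
      by_cases hrS : r ∈ S
      · refine ⟨S.erase r, fun s hs => ?_, ε, hε, fun x hx => ?_⟩
        · have := hS s (Finset.mem_of_mem_erase hs)
          exact ⟨this.1, by simp [this.2]⟩
        · have := hsign x hx
          rw [← Finset.mul_prod_erase S _ hrS] at this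
          convert this using 3
          ring
      · refine ⟨insert r S, fun s hs => ?_, ε, hε, fun x hx => ?_⟩
        · rcases Finset.mem_insert.1 hs with rfl | hs
          · exact ⟨hr, hfr⟩
          · exact ⟨(hS s hs).1, by simp [(hS s hs).2]⟩
        · have h1 := mul_nonneg (sq_nonneg (x - r)) (hsign x hx)
          rw [Finset.prod_insert hrS]
          simp only [eval_mul, eval_sub, eval_X, eval_C] at h1 ⊢
          linarith
    · push Not at hroot
      have hhalf : (1 / 2 : ℝ) ∈ Set.Ioo (0 : ℝ) 1 := by norm_num
      refine ⟨∅, by simp, f.eval (1 / 2), hroot _ hhalf, fun x hx => ?_⟩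
      simp only [Finset.prod_empty, mul_one]
      by_contra! hneg
      have himg : Set.OrdConnected ((fun y => f.eval y) '' Set.Ioo (0 : ℝ) 1) :=
        (isPreconnected_Ioo.image _ f.continuous.continuousOn).ordConnected
      have hzero : (0 : ℝ) ∈ (fun y => f.eval y) '' Set.Ioo (0 : ℝ) 1 := by
        rcases mul_neg_iff.1 hneg with ⟨h1, h2⟩ | ⟨h1, h2⟩
        · exact himg.out ⟨x, hx, rfl⟩ ⟨_, hhalf, rfl⟩ ⟨h2.le, h1.le⟩
        · exact himg.out ⟨_, hhalf, rfl⟩ ⟨x, hx, rfl⟩ ⟨h1.le, h2.le⟩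
      obtain ⟨y, hy, hy0⟩ := hzero
      exact hroot y hy hy0

/-- A polynomial orthogonal to all polynomials of degree less than `n` has `n` roots in the open
unit interval. -/
lemma exists_roots_of_orthogonal (n : ℕ) (f ρ : ℝ[X])
    (hρ : ∀ x ∈ Set.Ioo (0 : ℝ) 1, 0 < ρ.eval x)
    (horth : ∀ w : ℝ[X], w.natDegree < n → unitIntegral (f * w * ρ) = 0) :
    ∃ S : Finset ℝ, #S = n ∧ ∀ r ∈ S, r ∈ Set.Ioo (0 : ℝ) 1 ∧ f.eval r = 0 := by
  suffices h : ∃ S : Finset ℝ, n ≤ #S ∧ ∀ r ∈ S, r ∈ Set.Ioo (0 : ℝ) 1 ∧ f.eval r = 0 by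
    obtain ⟨S, hn, hS⟩ := h
    obtain ⟨S', hsub, hcard⟩ := Finset.exists_subset_card_eq hn
    exact ⟨S', hcard, fun r hr => hS r (hsub hr)⟩
  by_cases hf : f = 0
  · obtain ⟨S, hS, hcard⟩ := (Set.Ioo_infinite (zero_lt_one' ℝ)).exists_subset_card_eq n
    exact ⟨S, hcard.ge, fun r hr => ⟨hS hr, by simp [hf]⟩⟩
  obtain ⟨S, hS, ε, hε, hsign⟩ := exists_roots_mul_prod_sign f hf
  refine ⟨S, ?_, hS⟩
  by_contra! hlt
  have hint := horth (∏ r ∈ S, (X - C r)) (by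
    rwa [natDegree_finsetProd_X_sub_C_eq_card])
  have hzero : ε • (f * ∏ r ∈ S, (X - C r)) * ρ = 0 := by
    refine eq_zero_of_unitIntegral_eq_zero (fun x hx => ?_) ?_
    · rw [eval_mul, eval_smul, smul_eq_mul]
      exact mul_nonneg (hsign x hx) (hρ x hx).le
    · rw [smul_mul_assoc, map_smul, hint, smul_zero]
  have hρ0 : ρ ≠ 0 := by
    rintro rfl
    simpa using hρ (1 / 2) (by norm_num)
  have hprod : ∏ r ∈ S, (X - C r) ≠ 0 := Finset.prod_ne_zero_iff.2 fun r _ => X_sub_C_ne_zero r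
  exact mul_ne_zero (smul_ne_zero hε (mul_ne_zero hf hprod)) hρ0 hzero

lemma eval_zero_mul_derivative_prod (S : Finset ℝ) (hS : ∀ r ∈ S, 0 < r) :
    (∏ r ∈ S, (X - C r)).eval 0 ≠ 0 ∧
    (∏ r ∈ S, (X - C r)).eval 0 * (derivative (∏ r ∈ S, (X - C r))).eval 0 ≤ 0 ∧
    (S.Nonempty →
      (∏ r ∈ S, (X - C r)).eval 0 * (derivative (∏ r ∈ S, (X - C r))).eval 0 < 0) := by
  induction S using Finset.induction_on with
  | empty => simp
  | insert r S hr ih =>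
    obtain ⟨h1, h2, -⟩ := ih fun s hs => hS s (Finset.mem_insert_of_mem hs)
    have hrpos := hS r (Finset.mem_insert_self _ _)
    rw [Finset.prod_insert hr]
    set Q := ∏ s ∈ S, (X - C s)
    have hneg : ((X - C r) * Q).eval 0 * (derivative ((X - C r) * Q)).eval 0 < 0 := by
      simp only [derivative_mul, derivative_sub, derivative_X, derivative_C, sub_zero, one_mul,
        eval_mul, eval_add, eval_sub, eval_X, eval_C, zero_sub]
      nlinarith [mul_pos hrpos (sq_pos_of_ne_zero h1),
        mul_nonneg (sq_nonneg r) (neg_nonneg.2 h2)]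
    refine ⟨?_, hneg.le, fun _ => hneg⟩
    simpa [hrpos.ne'] using h1

/-- An orthogonal polynomial of positive degree has a nonvanishing linear coefficient. -/
lemma eq_zero_of_orthogonal_of_coeff_one_eq_zero {n : ℕ} (hn : 1 ≤ n) (f ρ : ℝ[X])
    (hf : f.natDegree ≤ n) (hρ : ∀ x ∈ Set.Ioo (0 : ℝ) 1, 0 < ρ.eval x)
    (horth : ∀ w : ℝ[X], w.natDegree < n → unitIntegral (f * w * ρ) = 0)
    (hcoeff : f.coeff 1 = 0) : f = 0 := by
  obtain ⟨S, hcard, hS⟩ := exists_roots_of_orthogonal n f ρ hρ horth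
  obtain ⟨h1, -, h2⟩ := eval_zero_mul_derivative_prod S fun r hr => (hS r hr).1.1
  have hdvd : ∏ r ∈ S, (X - C r) ∣ f := by
    refine Finset.prod_dvd_of_coprime (fun a _ b _ hab => ?_) fun r hr =>
      dvd_iff_isRoot.2 (hS r hr).2
    exact isCoprime_X_sub_C_of_isUnit_sub (sub_ne_zero.2 hab).isUnit
  obtain ⟨g, hg⟩ := hdvd
  by_contra hf0
  have hg0 : g ≠ 0 := by rintro rfl; simp at hg; exact hf0 hg
  have hP0 : ∏ r ∈ S, (X - C r) ≠ 0 := Finset.prod_ne_zero_iff.2 fun r _ => X_sub_C_ne_zero r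
  have hgd : g.natDegree = 0 := by
    have := congrArg natDegree hg
    rw [natDegree_mul hP0 hg0, natDegree_finsetProd_X_sub_C_eq_card, hcard] at this
    omega
  obtain ⟨c, rfl⟩ := natDegree_eq_zero.1 hgd
  have hc : c ≠ 0 := by simpa using hg0
  have hder : (derivative f).eval 0 = 0 := by
    rw [← coeff_zero_eq_eval_zero, coeff_derivative]
    simp [hcoeff]
  rw [hg] at hder
  simp only [derivative_mul, derivative_C, mul_zero, add_zero, eval_mul, eval_C] at hder
  have := h2 (Finset.card_pos.1 (by omega))
  rcases mul_eq_zero.1 hder with h | h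
  · rw [h, mul_zero] at this; exact lt_irrefl _ this
  · exact hc h

/-- The radial moments `∫₀¹ s ^ (l + 3) (1 - s) ds`. -/
def radialMoment (l : ℕ) : ℝ := unitIntegral (X ^ (l + 3) * (1 - X))

lemma eq_zero_of_sum_radialMoment {n m : ℕ} (hm : 1 ≤ m) (c : ℕ → ℝ)
    (hlow : ∀ k < m, c k = 0)
    (horth : ∀ j, m ≤ j + 1 → j < n → ∑ k ∈ range (n + 1), radialMoment (k + j) * c k = 0) :
    ∀ k ≤ n, c k = 0 := by
  set g : ℝ[X] := ∑ k ∈ range (n + 1), c k • X ^ k with hg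
  have hsq : unitIntegral (g ^ 2 * (X ^ 2 * (1 - X))) = 0 := by
    have hterm : ∀ l ∈ range (n + 1),
        unitIntegral (c l • X ^ l * g * (X ^ 2 * (1 - X))) = 0 := by
      intro l hl
      by_cases hlm : l < m
      · simp [hlow l hlm]
      have hl' := Finset.mem_range.1 hl
      obtain ⟨j, rfl⟩ : ∃ j, l = j + 1 := ⟨l - 1, by omega⟩
      have h := horth j (by omega) (by omega)
      have heq : c (j + 1) • X ^ (j + 1) * g * (X ^ 2 * (1 - X)) =
          c (j + 1) • ∑ k ∈ range (n + 1), c k • (X ^ (k + j + 3) * (1 - X)) := by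
        rw [hg, Finset.mul_sum, Finset.sum_mul, Finset.smul_sum]
        refine Finset.sum_congr rfl fun k _ => ?_
        simp only [smul_eq_C_mul]
        ring
      rw [heq, map_smul, map_sum]
      simp only [map_smul, smul_eq_mul]
      rw [mul_eq_zero]
      right
      rw [← h]
      exact Finset.sum_congr rfl fun k _ => mul_comm _ _
    have heq : g ^ 2 * (X ^ 2 * (1 - X)) =
        ∑ l ∈ range (n + 1), c l • X ^ l * g * (X ^ 2 * (1 - X)) := by
      rw [← Finset.sum_mul, ← Finset.sum_mul, ← hg, sq]
    rw [heq, map_sum]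
    exact Finset.sum_eq_zero hterm
  have h0 : g ^ 2 * (X ^ 2 * (1 - X)) = 0 := by
    refine eq_zero_of_unitIntegral_eq_zero (fun x hx => ?_) hsq
    simp only [eval_mul, eval_pow, eval_X, eval_sub, eval_one]
    exact mul_nonneg (sq_nonneg _) (mul_nonneg (sq_nonneg _) (sub_nonneg.2 hx.2.le))
  have hρ0 : (X ^ 2 * (1 - X) : ℝ[X]) ≠ 0 := by
    intro h
    have := congrArg (eval (1 / 2)) h
    norm_num at this
  have hg0 : g = 0 := by simpa [hρ0] using h0
  intro k hk
  have := congrArg (fun p => coeff p k) hg0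
  simpa [hg, finsetSum_coeff, coeff_X_pow, Nat.lt_succ_iff, hk] using this

lemma coeff_zero_eq_zero_of_sum_radialMoment {n : ℕ} (hn : 1 ≤ n) (c : ℕ → ℝ) (hone : c 1 = 0)
    (horth : ∀ j < n, ∑ k ∈ range (n + 1), radialMoment (k + j) * c k = 0) : c 0 = 0 := by
  set g : ℝ[X] := ∑ k ∈ range (n + 1), c k • X ^ k with hg
  have hcoeff : ∀ k ≤ n, g.coeff k = c k := fun k hk => by
    simp [hg, finsetSum_coeff, coeff_X_pow, hk]
  rw [← hcoeff 0 (Nat.zero_le _)]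
  rw [eq_zero_of_orthogonal_of_coeff_one_eq_zero hn g (X ^ 3 * (1 - X)), coeff_zero]
  · refine natDegree_sum_le_of_forall_le _ _ fun k hk => ?_
    exact (natDegree_smul_le _ _).trans
      ((natDegree_X_pow_le _).trans (Nat.lt_succ_iff.1 (Finset.mem_range.1 hk)))
  · intro x hx
    simp only [eval_mul, eval_pow, eval_X, eval_sub, eval_one]
    exact mul_pos (pow_pos hx.1 _) (sub_pos.2 hx.2)
  · intro w hw
    rw [w.as_sum_range' n hw, Finset.mul_sum, Finset.sum_mul, map_sum]
    refine Finset.sum_eq_zero fun j hj => ?_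
    have h := horth j (Finset.mem_range.1 hj)
    have heq : g * monomial j (w.coeff j) * (X ^ 3 * (1 - X)) =
        w.coeff j • ∑ k ∈ range (n + 1), c k • (X ^ (k + j + 3) * (1 - X)) := by
      rw [hg, Finset.sum_mul, Finset.sum_mul, Finset.smul_sum]
      refine Finset.sum_congr rfl fun k _ => ?_
      simp only [smul_eq_C_mul, ← C_mul_X_pow_eq_monomial]
      ring
    rw [heq, map_smul, map_sum]
    simp only [map_smul, smul_eq_mul]
    rw [mul_eq_zero]
    right
    rw [← h]
    exact Finset.sum_congr rfl fun k _ => mul_comm _ _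
  · rw [hcoeff 1 hn, hone]

end UnivariatePolynomials

section BivariatePolynomials

open MvPolynomial

/-- The polynomial `x ↦ u (z + x)`. -/
def recenter (z : ℝ × ℝ) (u : MvPolynomial (Fin 2) ℝ) : MvPolynomial (Fin 2) ℝ :=
  aeval (fun i => X i + C (![z.1, z.2] i)) u

lemma evalP_mul (u v : MvPolynomial (Fin 2) ℝ) (p : ℝ × ℝ) :
    evalP (u * v) p = evalP u p * evalP v p := by simp [evalP]

lemma evalP_sum {ι : Type*} (s : Finset ι) (u : ι → MvPolynomial (Fin 2) ℝ) (p : ℝ × ℝ) :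
    evalP (∑ i ∈ s, u i) p = ∑ i ∈ s, evalP (u i) p := by simp [evalP]

lemma eq_zero_of_forall_evalP {u : MvPolynomial (Fin 2) ℝ} (h : ∀ p, evalP u p = 0) : u = 0 := by
  refine MvPolynomial.funext fun x => ?_
  have : x = ![x 0, x 1] := by ext i; fin_cases i <;> rfl
  rw [this]
  simpa [evalP] using h (x 0, x 1)

lemma evalP_recenter (z x : ℝ × ℝ) (u : MvPolynomial (Fin 2) ℝ) :
    evalP (recenter z u) x = evalP u (z + x) := by
  have h : (eval ![x.1, x.2]).comp
      (aeval (fun i => X i + C (![z.1, z.2] i)) :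
        MvPolynomial (Fin 2) ℝ →ₐ[ℝ] MvPolynomial (Fin 2) ℝ).toRingHom =
      eval ![(z + x).1, (z + x).2] := by
    refine MvPolynomial.ringHom_ext (fun r => by simp) fun i => ?_
    fin_cases i <;> simp [add_comm]
  exact congrArg (fun φ => φ u) h

lemma totalDegree_recenter_le (z : ℝ × ℝ) (u : MvPolynomial (Fin 2) ℝ) :
    (recenter z u).totalDegree ≤ u.totalDegree := by
  rw [recenter, aeval_def, eval₂_eq']
  refine totalDegree_finsetSum_le fun d hd => ?_
  refine (totalDegree_mul _ _).trans ?_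
  rw [algebraMap_eq, totalDegree_C, zero_add]
  refine (totalDegree_finsetProd _ _).trans (le_trans ?_ (le_totalDegree hd))
  rw [Finsupp.sum_fintype _ _ (fun _ => rfl)]
  refine Finset.sum_le_sum fun i _ => (totalDegree_pow _ _).trans ?_
  have : (X i + C (![z.1, z.2] i) : MvPolynomial (Fin 2) ℝ).totalDegree ≤ 1 :=
    (totalDegree_add _ _).trans (by simp)
  nlinarith

/-- The homogeneous part of degree `k` of `u` about the centre `z`. -/
def componentAt (z : ℝ × ℝ) (u : MvPolynomial (Fin 2) ℝ) (k : ℕ) : MvPolynomial (Fin 2) ℝ :=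
  homogeneousComponent k (recenter z u)

lemma componentAt_isHomogeneous (z : ℝ × ℝ) (u : MvPolynomial (Fin 2) ℝ) (k : ℕ) :
    (componentAt z u k).IsHomogeneous k := homogeneousComponent_isHomogeneous _ _

lemma degree_eq_apply_zero_add_apply_one {h : MvPolynomial (Fin 2) ℝ}
    {m : ℕ} (hh : h.IsHomogeneous m) {d : Fin 2 →₀ ℕ} (hd : d ∈ h.support) :
    d 0 + d 1 = m := by
  have hsum := hh.degree_eq_sum_deg_support hd
  rw [hsum, Finset.sum_subset (Finset.subset_univ _)
    (fun i _ hi => Finsupp.notMem_support_iff.1 hi), Fin.sum_univ_two]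

lemma evalP_smul {h : MvPolynomial (Fin 2) ℝ} {m : ℕ} (hh : h.IsHomogeneous m) (c : ℝ)
    (p : ℝ × ℝ) : evalP h (c • p) = c ^ m * evalP h p := by
  simp only [evalP, eval_eq', Finset.mul_sum]
  refine Finset.sum_congr rfl fun d hd => ?_
  have hdeg := degree_eq_apply_zero_add_apply_one hh hd
  simp only [Fin.prod_univ_two, Prod.smul_fst, Prod.smul_snd, smul_eq_mul, Matrix.cons_val_zero,
    Matrix.cons_val_one, ← hdeg]
  ring

lemma evalP_add_smul {u : MvPolynomial (Fin 2) ℝ} {n : ℕ} (hu : u.totalDegree ≤ n)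
    (z x : ℝ × ℝ) (s : ℝ) :
    evalP u (z + s • x) = ∑ k ∈ range (n + 1), s ^ k * evalP (componentAt z u k) x := by
  have hsum : recenter z u = ∑ k ∈ range (n + 1), componentAt z u k := by
    conv_lhs => rw [← sum_homogeneousComponent (recenter z u)]
    refine Finset.sum_subset (Finset.range_mono ?_) fun k _ hk => ?_
    · have := totalDegree_recenter_le z u
      omega
    · exact homogeneousComponent_eq_zero _ _ (by simpa using hk)
  rw [← evalP_recenter, hsum, evalP_sum]
  exact Finset.sum_congr rfl fun k _ => evalP_smul (componentAt_isHomogeneous z u k) s x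

/-- The restriction `t ↦ h (p + t d)` of a bivariate polynomial to a line. -/
def lineRestrict (p d : ℝ × ℝ) (h : MvPolynomial (Fin 2) ℝ) : Polynomial ℝ :=
  aeval ![Polynomial.C p.1 + Polynomial.C d.1 * Polynomial.X,
    Polynomial.C p.2 + Polynomial.C d.2 * Polynomial.X] h

lemma eval_lineRestrict (p d : ℝ × ℝ) (h : MvPolynomial (Fin 2) ℝ) (t : ℝ) :
    (lineRestrict p d h).eval t = evalP h (p + t • d) := by
  have hcomp : (Polynomial.evalRingHom t).comp
      (aeval ![Polynomial.C p.1 + Polynomial.C d.1 * Polynomial.X,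
        Polynomial.C p.2 + Polynomial.C d.2 * Polynomial.X] :
        MvPolynomial (Fin 2) ℝ →ₐ[ℝ] Polynomial ℝ).toRingHom =
      eval ![(p + t • d).1, (p + t • d).2] := by
    refine MvPolynomial.ringHom_ext (fun r => by simp) fun i => ?_
    fin_cases i <;> simp <;> ring
  exact congrArg (fun φ => φ h) hcomp

lemma natDegree_lineRestrict_le (p d : ℝ × ℝ) (h : MvPolynomial (Fin 2) ℝ) :
    (lineRestrict p d h).natDegree ≤ h.totalDegree := by
  have hdeg : ∀ i, (![Polynomial.C p.1 + Polynomial.C d.1 * Polynomial.X,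
      Polynomial.C p.2 + Polynomial.C d.2 * Polynomial.X] i).natDegree ≤ 1 := by
    intro i
    fin_cases i <;>
      simp only [Fin.zero_eta, Fin.mk_one, Matrix.cons_val_zero, Matrix.cons_val_one] <;>
      compute_degree
  rw [← mul_one h.totalDegree]
  exact aeval_natDegree_le h le_rfl _ hdeg

lemma evalP_linear {h : MvPolynomial (Fin 2) ℝ} (hh : h.IsHomogeneous 1) (α β : ℝ)
    (a b : ℝ × ℝ) : evalP h (α • a + β • b) = α * evalP h a + β * evalP h b := by
  simp only [evalP, eval_eq', Finset.mul_sum, ← Finset.sum_add_distrib]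
  refine Finset.sum_congr rfl fun d hd => ?_
  have hdeg := degree_eq_apply_zero_add_apply_one hh hd
  rcases (by omega : d 0 = 0 ∧ d 1 = 1 ∨ d 0 = 1 ∧ d 1 = 0) with ⟨h0, h1⟩ | ⟨h0, h1⟩ <;>
  · simp only [Fin.prod_univ_two, Matrix.cons_val_zero, Matrix.cons_val_one, h0, h1, Prod.fst_add,
      Prod.snd_add, Prod.smul_fst, Prod.smul_snd, smul_eq_mul, pow_zero, pow_one]
    ring

end BivariatePolynomials

section Triangles

variable {z A B : ℝ × ℝ}

lemma det2_ne_zero_of_affineIndependent (h : AffineIndependent ℝ ![z, A, B]) :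
    det2 (A - z) (B - z) ≠ 0 := by
  rw [affineIndependent_iff_linearIndependent_vsub ℝ _ (0 : Fin 3)] at h
  have h2 : LinearIndependent ℝ ![A - z, B - z] := by
    let e : Fin 2 → {x : Fin 3 // x ≠ 0} := ![⟨1, by decide⟩, ⟨2, by decide⟩]
    have he : Function.Injective e := by decide
    have heq : (fun i : {x : Fin 3 // x ≠ 0} => ![z, A, B] i -ᵥ ![z, A, B] 0) ∘ e =
        ![A - z, B - z] := by
      funext i
      fin_cases i <;> rfl
    exact heq ▸ h.comp e he
  rw [LinearIndependent.pair_iff] at h2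
  intro hdet
  have hx := h2 (B - z).1 (-(A - z).1) (by
    ext
    · simp; ring
    · simp only [det2] at hdet
      simp only [Prod.snd_add, Prod.smul_snd, smul_eq_mul, Prod.snd_zero]
      linarith)
  have hy := h2 (B - z).2 (-(A - z).2) (by
    ext
    · simp only [det2] at hdet
      simp only [Prod.fst_add, Prod.smul_fst, smul_eq_mul, Prod.fst_zero]
      linarith
    · simp; ring)
  have h10 := h2 1 0 (by
    ext
    · simpa [sub_eq_zero, eq_comm] using hx.2
    · simpa [sub_eq_zero, eq_comm] using hy.2)
  exact one_ne_zero h10.1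

lemma affineSpan_eq_top_of_affineIndependent (h : AffineIndependent ℝ ![z, A, B]) :
    affineSpan ℝ (Set.range ![z, A, B]) = ⊤ := by
  rw [h.affineSpan_eq_top_iff_card_eq_finrank_add_one]
  simp

/-- The vertices of a nondegenerate triangle as an affine basis of the plane. -/
def triangleBasis (h : AffineIndependent ℝ ![z, A, B]) : AffineBasis (Fin 3) ℝ (ℝ × ℝ) :=
  ⟨![z, A, B], h, affineSpan_eq_top_of_affineIndependent h⟩

lemma eq_add_coord_smul (h : AffineIndependent ℝ ![z, A, B]) (x : ℝ × ℝ) :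
    x = z + (triangleBasis h).coord 1 x • (A - z) + (triangleBasis h).coord 2 x • (B - z) := by
  have h1 := (triangleBasis h).linear_combination_coord_eq_self x
  have h2 := (triangleBasis h).sum_coord_apply_eq_one x
  rw [Fin.sum_univ_three] at h1 h2
  have hz : (triangleBasis h) 0 = z := rfl
  have hA : (triangleBasis h) 1 = A := rfl
  have hB : (triangleBasis h) 2 = B := rfl
  rw [hz, hA, hB] at h1
  rw [← eq_sub_iff_add_eq, ← eq_sub_iff_add_eq] at h2
  conv_lhs => rw [← h1, h2]
  module

lemma coord_add_smul (h : AffineIndependent ℝ ![z, A, B]) (α β : ℝ) (i : Fin 3) :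
    (triangleBasis h).coord i (z + α • (A - z) + β • (B - z)) = ![1 - α - β, α, β] i := by
  have hw : ∑ i, ![1 - α - β, α, β] i = 1 := by
    rw [Fin.sum_univ_three]
    change 1 - α - β + α + β = 1
    ring
  rw [← (triangleBasis h).coord_apply_combination_of_mem (Finset.mem_univ i) hw,
    Finset.affineCombination_eq_linear_combination _ _ _ hw, Fin.sum_univ_three]
  congr 1
  change _ = (1 - α - β) • z + α • A + β • B
  module

lemma range_triangle : Set.range ![z, A, B] = {z, A, B} := by
  rw [Matrix.range_cons, Matrix.range_cons, Matrix.range_cons, Matrix.range_empty, Set.union_empty]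
  rfl

lemma mem_tri_iff (h : AffineIndependent ℝ ![z, A, B]) (x : ℝ × ℝ) :
    x ∈ tri z A B ↔
      ∃ α β : ℝ, 0 < α ∧ 0 < β ∧ α + β < 1 ∧ x = z + α • (A - z) + β • (B - z) := by
  have htri : tri z A B = {x | ∀ i, 0 < (triangleBasis h).coord i x} := by
    rw [← AffineBasis.interior_convexHull, tri, ← range_triangle]
    rfl
  rw [htri, Set.mem_ofPred_eq]
  constructor
  · intro hx
    refine ⟨_, _, hx 1, hx 2, ?_, eq_add_coord_smul h x⟩
    have h2 := (triangleBasis h).sum_coord_apply_eq_one x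
    rw [Fin.sum_univ_three] at h2
    linarith [hx 0]
  · rintro ⟨α, β, hα, hβ, hαβ, rfl⟩ i
    rw [coord_add_smul]
    fin_cases i <;> simp <;> linarith

lemma exists_nonneg_of_mem_closure_tri (h : AffineIndependent ℝ ![z, A, B]) {x : ℝ × ℝ}
    (hx : x ∈ closure (tri z A B)) :
    ∃ α β : ℝ, 0 ≤ α ∧ 0 ≤ β ∧ x = z + α • (A - z) + β • (B - z) := by
  have hclosed : IsClosed (convexHull ℝ ({z, A, B} : Set (ℝ × ℝ))) :=
    (Set.toFinite _).isClosed_convexHull ℝ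
  have hx' := closure_minimal interior_subset hclosed hx
  rw [← range_triangle] at hx'
  have hx'' : x ∈ {x | ∀ i, 0 ≤ (triangleBasis h).coord i x} := by
    rw [← AffineBasis.convexHull_eq_nonneg_coord]
    exact hx'
  exact ⟨_, _, hx'' 1, hx'' 2, eq_add_coord_smul h x⟩

lemma bubble_add_smul (h : det2 (A - z) (B - z) ≠ 0) (α β : ℝ) :
    bubble z A B (z + α • (A - z) + β • (B - z)) = (1 - α - β) * α * β := by
  have h1 : bary z A B (z + α • (A - z) + β • (B - z)) = 1 - α - β := by
    have hD : det2 (z - A) (B - A) ≠ 0 := by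
      convert neg_ne_zero.2 h using 1
      simp [det2]; ring
    rw [bary, div_eq_iff hD]
    simp [det2]; ring
  have h2 : bary A B z (z + α • (A - z) + β • (B - z)) = α := by
    have hD : det2 (A - B) (z - B) ≠ 0 := by
      convert neg_ne_zero.2 h using 1
      simp [det2]; ring
    rw [bary, div_eq_iff hD]
    simp [det2]; ring
  have h3 : bary B z A (z + α • (A - z) + β • (B - z)) = β := by
    have hD : det2 (B - z) (A - z) ≠ 0 := by
      convert neg_ne_zero.2 h using 1
      simp [det2]; ring
    rw [bary, div_eq_iff hD]
    simp [det2]; ring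
  rw [bubble, h1, h2, h3]

end Triangles

section DuffyTransform

/-- The Duffy map from the square onto a triangle with apex `z`. -/
def duffy (z a b : ℝ × ℝ) (p : ℝ × ℝ) : ℝ × ℝ := z + p.1 • (a + p.2 • (b - a))

/-- The derivative of the Duffy map. -/
def duffyDeriv (a b : ℝ × ℝ) (p : ℝ × ℝ) : ℝ × ℝ →L[ℝ] ℝ × ℝ :=
  (Matrix.toLin (.finTwoProd ℝ) (.finTwoProd ℝ)
    !![a.1 + p.2 * (b.1 - a.1), p.1 * (b.1 - a.1);
      a.2 + p.2 * (b.2 - a.2), p.1 * (b.2 - a.2)]).toContinuousLinearMap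

lemma det_duffyDeriv (a b p : ℝ × ℝ) : (duffyDeriv a b p).det = p.1 * det2 a b := by
  unfold duffyDeriv
  rw [ContinuousLinearMap.det, LinearMap.coe_toContinuousLinearMap, LinearMap.det_toLin,
    Matrix.det_fin_two_of, det2]
  ring

lemma hasFDerivAt_duffy (z a b p : ℝ × ℝ) :
    HasFDerivAt (duffy z a b) (duffyDeriv a b p) p := by
  have h : ∀ c d e : ℝ, HasFDerivAt (fun q : ℝ × ℝ => c + q.1 * (d + q.2 * e))
      ((d + p.2 * e) • ContinuousLinearMap.fst ℝ ℝ ℝ + (p.1 * e) • ContinuousLinearMap.snd ℝ ℝ ℝ)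
      p := by
    intro c d e
    have h1 : HasFDerivAt (fun q : ℝ × ℝ => q.1) (ContinuousLinearMap.fst ℝ ℝ ℝ) p :=
      hasFDerivAt_fst
    have h2 : HasFDerivAt (fun q : ℝ × ℝ => q.2) (ContinuousLinearMap.snd ℝ ℝ ℝ) p :=
      hasFDerivAt_snd
    refine ((h1.mul ((h2.mul_const e).const_add d)).const_add c).congr_fderiv ?_
    ext <;> simp [mul_comm]
  unfold duffyDeriv
  rw [Matrix.toLin_finTwoProd_toContinuousLinearMap]
  exact (h z.1 a.1 (b.1 - a.1)).prodMk (h z.2 a.2 (b.2 - a.2))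

lemma det2_linearCombination_left (a b : ℝ × ℝ) (α β : ℝ) :
    det2 (α • a + β • b) b = α * det2 a b := by simp [det2]; ring

lemma det2_linearCombination_right (a b : ℝ × ℝ) (α β : ℝ) :
    det2 a (α • a + β • b) = β * det2 a b := by simp [det2]; ring

lemma linearCombination_injective {a b : ℝ × ℝ} (h : det2 a b ≠ 0) {α β α' β' : ℝ}
    (heq : α • a + β • b = α' • a + β' • b) : α = α' ∧ β = β' := by
  have h1 := congrArg (fun x => det2 x b) heq
  have h2 := congrArg (fun x => det2 a x) heq
  simp only [det2_linearCombination_left, det2_linearCombination_right] at h1 h2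
  exact ⟨mul_right_cancel₀ h h1, mul_right_cancel₀ h h2⟩

lemma exists_linearCombination {a b : ℝ × ℝ} (h : det2 a b ≠ 0) (x : ℝ × ℝ) :
    ∃ α β : ℝ, x = α • a + β • b := by
  refine ⟨det2 x b / det2 a b, det2 a x / det2 a b, ?_⟩
  rw [det2] at h
  ext <;>
  · simp only [det2, Prod.fst_add, Prod.snd_add, Prod.smul_fst, Prod.smul_snd, smul_eq_mul]
    rw [div_mul_eq_mul_div, div_mul_eq_mul_div, ← add_div, eq_div_iff h]
    ring

lemma duffy_eq (z a b p : ℝ × ℝ) :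
    duffy z a b p = z + ((p.1 * (1 - p.2)) • a + (p.1 * p.2) • b) := by
  rw [duffy]; module

lemma injOn_duffy {z a b : ℝ × ℝ} (h : det2 a b ≠ 0) :
    Set.InjOn (duffy z a b) (Set.Ioo (0 : ℝ) 1 ×ˢ Set.Ioo (0 : ℝ) 1) := by
  rintro ⟨s, t⟩ ⟨hs, ht⟩ ⟨s', t'⟩ ⟨hs', ht'⟩ heq
  rw [duffy_eq, duffy_eq] at heq
  obtain ⟨h1, h2⟩ := linearCombination_injective h (add_left_cancel heq)
  simp only at h1 h2 hs hs'
  obtain rfl : s = s' := by linarith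
  exact Prod.ext rfl (mul_left_cancel₀ hs.1.ne' h2)

lemma tri_eq_image_duffy {z A B : ℝ × ℝ} (h : AffineIndependent ℝ ![z, A, B]) :
    tri z A B = duffy z (A - z) (B - z) '' (Set.Ioo (0 : ℝ) 1 ×ˢ Set.Ioo (0 : ℝ) 1) := by
  ext x
  rw [mem_tri_iff h]
  constructor
  · rintro ⟨α, β, hα, hβ, hαβ, rfl⟩
    have hpos : 0 < α + β := add_pos hα hβ
    refine ⟨(α + β, β / (α + β)), ⟨⟨hpos, hαβ⟩, ⟨by positivity, ?_⟩⟩, ?_⟩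
    · exact (div_lt_one hpos).2 (by linarith)
    · rw [duffy_eq, ← add_assoc]
      congr 3
      · field_simp
        ring
      · field_simp
  · rintro ⟨⟨s, t⟩, ⟨⟨hs0, hs1⟩, ⟨ht0, ht1⟩⟩, rfl⟩
    simp only at hs0 hs1 ht0 ht1
    refine ⟨s * (1 - t), s * t, by nlinarith, by positivity, by linarith, ?_⟩
    rw [duffy_eq, add_assoc]

open Polynomial in
/-- The weighted moment of the degree `k` part of `u` on the edge opposite to `z`. -/
def edgeMoment (z A B : ℝ × ℝ) (u : MvPolynomial (Fin 2) ℝ) (v : ℝ[X]) (k : ℕ) : ℝ :=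
  unitIntegral (lineRestrict (A - z) (B - A) (componentAt z u k) * v * (X * (1 - X)))

open Polynomial in
lemma setIntegral_Ioo_eval (F : ℝ[X]) :
    ∫ x in Set.Ioo (0 : ℝ) 1, F.eval x = unitIntegral F := by
  rw [unitIntegral_apply, intervalIntegral.integral_of_le zero_le_one, integral_Ioc_eq_integral_Ioo]

open Polynomial in
lemma innerT_eq_sum {z A B : ℝ × ℝ} (h : AffineIndependent ℝ ![z, A, B])
    {u w : MvPolynomial (Fin 2) ℝ} {n j : ℕ} (hu : u.totalDegree ≤ n) {v : ℝ[X]}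
    (hw : ∀ s t : ℝ, evalP w (duffy z (A - z) (B - z) (s, t)) = s ^ j * v.eval t) :
    innerT z A B u w = |det2 (A - z) (B - z)| *
      ∑ k ∈ range (n + 1), radialMoment (k + j) * edgeMoment z A B u v k := by
  have hD := det2_ne_zero_of_affineIndependent h
  set S : Set (ℝ × ℝ) := Set.Ioo (0 : ℝ) 1 ×ˢ Set.Ioo (0 : ℝ) 1 with hS
  have hSm : MeasurableSet S := measurableSet_Ioo.prod measurableSet_Ioo
  rw [innerT, tri_eq_image_duffy h, integral_image_eq_integral_abs_det_fderiv_smul volume hSm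
    (fun p _ => (hasFDerivAt_duffy z (A - z) (B - z) p).hasFDerivWithinAt) (injOn_duffy hD)]
  have hcongr : ∀ p ∈ S, |(duffyDeriv (A - z) (B - z) p).det| •
      (evalP u (duffy z (A - z) (B - z) p) * evalP w (duffy z (A - z) (B - z) p) *
        bubble z A B (duffy z (A - z) (B - z) p)) =
      ∑ k ∈ range (n + 1), |det2 (A - z) (B - z)| *
        ((X ^ (k + j + 3) * (1 - X) : ℝ[X]).eval p.1 *
        (lineRestrict (A - z) (B - A) (componentAt z u k) * v * (X * (1 - X))).eval p.2) := by
    rintro ⟨s, t⟩ ⟨hs, ht⟩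
    rw [det_duffyDeriv, hw, abs_mul, abs_of_pos hs.1, duffy_eq, ← add_assoc, bubble_add_smul hD,
      add_assoc, ← duffy_eq, duffy, evalP_add_smul hu, smul_eq_mul, Finset.sum_mul, Finset.sum_mul,
      Finset.mul_sum]
    refine Finset.sum_congr rfl fun k _ => ?_
    simp only [eval_mul, eval_pow, eval_X, eval_sub, eval_one, eval_lineRestrict,
      sub_sub_sub_cancel_right]
    ring
  rw [setIntegral_congr_fun hSm hcongr, integral_finsetSum, Finset.mul_sum]
  · refine Finset.sum_congr rfl fun k _ => ?_
    rw [integral_const_mul, hS, Measure.volume_eq_prod]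
    refine congrArg _ ((setIntegral_prod_mul (L := ℝ)
      (fun s => (X ^ (k + j + 3) * (1 - X) : ℝ[X]).eval s)
      (fun t => (lineRestrict (A - z) (B - A) (componentAt z u k) * v * (X * (1 - X))).eval t)
      _ _).trans ?_)
    rw [setIntegral_Ioo_eval, setIntegral_Ioo_eval]
    rfl
  · intro k _
    refine IntegrableOn.mono_set (t := Set.Icc (0 : ℝ) 1 ×ˢ Set.Icc (0 : ℝ) 1) ?_
      (Set.prod_mono Set.Ioo_subset_Icc_self Set.Ioo_subset_Icc_self)
    refine ContinuousOn.integrableOn_compact (isCompact_Icc.prod isCompact_Icc)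
      (Continuous.continuousOn ?_)
    exact continuous_const.mul (((Polynomial.continuous _).comp continuous_fst).mul
      ((Polynomial.continuous _).comp continuous_snd))

/-- Linear polynomials realizing the coordinates dual to a basis. -/
lemma exists_evalP_eq_coords (z : ℝ × ℝ) {a b : ℝ × ℝ} (h : det2 a b ≠ 0) :
    ∃ P Q : MvPolynomial (Fin 2) ℝ, P.totalDegree ≤ 1 ∧ Q.totalDegree ≤ 1 ∧
      ∀ α β : ℝ, evalP P (z + (α • a + β • b)) = α ∧ evalP Q (z + (α • a + β • b)) = β := by
  have hdeg : ∀ c d : ℝ, (MvPolynomial.C c * (MvPolynomial.X 0 - MvPolynomial.C z.1) +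
      MvPolynomial.C d * (MvPolynomial.X 1 - MvPolynomial.C z.2) :
      MvPolynomial (Fin 2) ℝ).totalDegree ≤ 1 := by
    intro c d
    refine (MvPolynomial.totalDegree_add _ _).trans (max_le ?_ ?_) <;>
    · refine (MvPolynomial.totalDegree_mul _ _).trans ?_
      rw [MvPolynomial.totalDegree_C, zero_add]
      exact (MvPolynomial.totalDegree_sub_C_le _ _).trans (by simp)
  refine ⟨_, _, hdeg (b.2 / det2 a b) (-b.1 / det2 a b), hdeg (-a.2 / det2 a b) (a.1 / det2 a b),
    fun α β => ?_⟩
  rw [det2] at h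
  constructor <;>
  · simp only [evalP, det2, map_add, map_mul, map_sub, MvPolynomial.eval_C, MvPolynomial.eval_X,
      Matrix.cons_val_zero, Matrix.cons_val_one, Prod.fst_add, Prod.snd_add, Prod.smul_fst,
      Prod.smul_snd, smul_eq_mul]
    rw [div_mul_eq_mul_div, div_mul_eq_mul_div, ← add_div, div_eq_iff h]
    ring

open Polynomial in
lemma exists_evalP_duffy (z : ℝ × ℝ) {a b : ℝ × ℝ} (h : det2 a b ≠ 0) (v : ℝ[X]) (j : ℕ)
    (hv : v.natDegree ≤ j) :
    ∃ w : MvPolynomial (Fin 2) ℝ, w.totalDegree ≤ j ∧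
      ∀ s t : ℝ, evalP w (duffy z a b (s, t)) = s ^ j * v.eval t := by
  obtain ⟨P, Q, hP, hQ, hPQ⟩ := exists_evalP_eq_coords z h
  refine ⟨∑ d ∈ range (j + 1), MvPolynomial.C (v.coeff d) * (Q ^ d * (P + Q) ^ (j - d)), ?_, ?_⟩
  · refine MvPolynomial.totalDegree_finsetSum_le fun d hd => ?_
    have hd' := Finset.mem_range.1 hd
    refine (MvPolynomial.totalDegree_mul _ _).trans ?_
    rw [MvPolynomial.totalDegree_C, zero_add]
    refine (MvPolynomial.totalDegree_mul _ _).trans ?_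
    have h1 := (MvPolynomial.totalDegree_pow Q d).trans (Nat.mul_le_mul_left d hQ)
    have h2 := (MvPolynomial.totalDegree_pow (P + Q) (j - d)).trans
      (Nat.mul_le_mul_left (j - d) ((MvPolynomial.totalDegree_add P Q).trans (max_le hP hQ)))
    omega
  · intro s t
    rw [evalP_sum, eval_eq_sum_range' (Nat.lt_succ_of_le hv), Finset.mul_sum]
    refine Finset.sum_congr rfl fun d hd => ?_
    have hd' := Nat.lt_succ_iff.1 (Finset.mem_range.1 hd)
    have heval : ∀ F G : MvPolynomial (Fin 2) ℝ, ∀ x, evalP (MvPolynomial.C (v.coeff d) *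
        (F ^ d * (F + G) ^ (j - d))) x =
        v.coeff d * (evalP F x ^ d * (evalP F x + evalP G x) ^ (j - d)) := by
      intro F G x
      simp [evalP]
    rw [add_comm P Q, heval, duffy_eq, (hPQ _ _).1, (hPQ _ _).2]
    simp only
    rw [show s * t + s * (1 - t) = s by ring, mul_pow, ← Nat.add_sub_cancel' hd', pow_add,
      Nat.add_sub_cancel_left]
    ring

end DuffyTransform

section Patches

open Polynomial

variable {q : ℕ}

lemma TrianglePatch.neZero (T : TrianglePatch q) : NeZero q := ⟨by have := T.hq; omega⟩

/-- The point with parameter `t` on the `i`-th outer edge, relative to the centre. -/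
def TrianglePatch.edgePoint (T : TrianglePatch q) (i : ZMod q) (t : ℝ) : ℝ × ℝ :=
  (T.A (i - 1) - T.z) + t • (T.A i - T.A (i - 1))

lemma TrianglePatch.edgePoint_eq (T : TrianglePatch q) (i : ZMod q) (t : ℝ) :
    T.edgePoint i t = (1 - t) • (T.A (i - 1) - T.z) + t • (T.A i - T.z) := by
  rw [edgePoint]; module

lemma TrianglePatch.add_smul_edgePoint_mem (T : TrianglePatch q) (i : ZMod q) {s t : ℝ}
    (hs : s ∈ Set.Ioo (0 : ℝ) 1) (ht : t ∈ Set.Ioo (0 : ℝ) 1) :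
    T.z + s • T.edgePoint i t ∈ tri T.z (T.A (i - 1)) (T.A i) := by
  rw [tri_eq_image_duffy (T.indep i)]
  exact ⟨(s, t), ⟨hs, ht⟩, by rw [duffy, edgePoint, sub_sub_sub_cancel_right]⟩

lemma TrianglePatch.edgePoint_ne_zero (T : TrianglePatch q) (i : ZMod q) {t : ℝ}
    (ht : t ∈ Set.Ioo (0 : ℝ) 1) : T.edgePoint i t ≠ 0 := by
  intro h
  have h0 : (1 - t) • (T.A (i - 1) - T.z) + t • (T.A i - T.z) =
      (0 : ℝ) • (T.A (i - 1) - T.z) + (0 : ℝ) • (T.A i - T.z) := by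
    rw [← edgePoint_eq, h]; simp
  exact ht.1.ne' (linearCombination_injective (det2_ne_zero_of_affineIndependent (T.indep i)) h0).2

/-- Distinct points on the outer edges span distinct rays from the centre. -/
lemma TrianglePatch.edgePoint_eq_smul (T : TrianglePatch q) {i i' : ZMod q} {t t' c : ℝ}
    (ht : t ∈ Set.Ioo (0 : ℝ) 1) (ht' : t' ∈ Set.Ioo (0 : ℝ) 1) (hc : 0 < c)
    (h : T.edgePoint i' t' = c • T.edgePoint i t) : i = i' ∧ t = t' := by
  have hi : i = i' := by
    by_contra hne
    have hs : (1 + c)⁻¹ ∈ Set.Ioo (0 : ℝ) 1 := ⟨by positivity, inv_lt_one_of_one_lt₀ (by linarith)⟩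
    have hsc : (1 + c)⁻¹ * c ∈ Set.Ioo (0 : ℝ) 1 :=
      ⟨by positivity, by rw [inv_mul_lt_one₀ (by positivity)]; linarith⟩
    have h1 := T.add_smul_edgePoint_mem i' hs ht'
    rw [h, smul_smul] at h1
    exact Set.disjoint_left.1 (T.disj hne) (T.add_smul_edgePoint_mem i hsc ht) h1
  subst hi
  refine ⟨rfl, ?_⟩
  rw [T.edgePoint_eq, T.edgePoint_eq, smul_add, smul_smul, smul_smul] at h
  obtain ⟨h1, h2⟩ :=
    linearCombination_injective (det2_ne_zero_of_affineIndependent (T.indep i)) h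
  have hc1 : c = 1 := by linarith
  rw [hc1] at h2
  linarith

/-- A binary form of degree `m ≥ 1` with `m` roots on every outer edge of a patch vanishes. -/
lemma TrianglePatch.eq_zero_of_roots (T : TrianglePatch q) {h : MvPolynomial (Fin 2) ℝ} {m : ℕ}
    (hm : 1 ≤ m) (hh : h.IsHomogeneous m) (S : ZMod q → Finset ℝ) (hcard : ∀ i, #(S i) = m)
    (hS : ∀ i, ∀ t ∈ S i, t ∈ Set.Ioo (0 : ℝ) 1 ∧ evalP h (T.edgePoint i t) = 0) : h = 0 := by
  have hqz := T.neZero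
  by_contra hne
  obtain ⟨p₀, hp₀⟩ : ∃ p, evalP h p ≠ 0 := by
    by_contra! hall
    exact hne (eq_zero_of_forall_evalP hall)
  set δ : MvPolynomial (Fin 2) ℝ :=
    MvPolynomial.C p₀.1 * MvPolynomial.X 1 - MvPolynomial.C p₀.2 * MvPolynomial.X 0 with hδ
  have hδeval : ∀ x, evalP δ x = det2 p₀ x := fun x => by simp [hδ, evalP, det2]
  have hδ0 : δ ≠ 0 := by
    intro h0
    have hdet : ∀ x, det2 p₀ x = 0 := fun x => by rw [← hδeval, h0]; simp [evalP]
    have hp0 : p₀ = (0 : ℝ) • p₀ := by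
      ext
      · simpa [det2] using hdet (0, 1)
      · simpa [det2] using hdet (1, 0)
    rw [hp0, evalP_smul hh, zero_pow (by omega), zero_mul] at hp₀
    exact hp₀ rfl
  obtain ⟨p₁, hp₁⟩ : ∃ p, evalP (h * δ) p ≠ 0 := by
    by_contra! hall
    exact mul_ne_zero hne hδ0 (eq_zero_of_forall_evalP hall)
  rw [evalP_mul, hδeval] at hp₁
  have hdet : det2 p₀ p₁ ≠ 0 := right_ne_zero_of_mul hp₁
  set Q := lineRestrict p₀ p₁ h
  have hQ0 : Q ≠ 0 := by
    intro h0
    have := eval_lineRestrict p₀ p₁ h 0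
    rw [zero_smul, add_zero] at this
    rw [← this] at hp₀
    exact hp₀ (by change Q.eval 0 = 0; rw [h0, eval_zero])
  have hQdeg : Q.natDegree ≤ m := (natDegree_lineRestrict_le p₀ p₁ h).trans hh.totalDegree_le
  choose β γ hβγ using fun x => exists_linearCombination hdet x
  have hβ : ∀ i, ∀ t ∈ S i, β (T.edgePoint i t) ≠ 0 := by
    intro i t ht h0
    obtain ⟨ht1, ht2⟩ := hS i t ht
    have hx := hβγ (T.edgePoint i t)
    rw [h0, zero_smul, zero_add] at hx
    rw [hx, evalP_smul hh] at ht2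
    have hγ := eq_zero_of_pow_eq_zero
      ((mul_eq_zero.1 ht2).resolve_right (left_ne_zero_of_mul hp₁))
    rw [hγ, zero_smul] at hx
    exact T.edgePoint_ne_zero i ht1 hx
  have hfactor : ∀ i, ∀ t ∈ S i, T.edgePoint i t = β (T.edgePoint i t) •
      (p₀ + (γ (T.edgePoint i t) / β (T.edgePoint i t)) • p₁) := by
    intro i t ht
    rw [smul_add, smul_smul, mul_div_cancel₀ _ (hβ i t ht)]
    exact hβγ _
  let ψ : (Σ _ : ZMod q, ℝ) → Bool × ℝ := fun x =>
    (decide (0 < β (T.edgePoint x.1 x.2)), γ (T.edgePoint x.1 x.2) / β (T.edgePoint x.1 x.2))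
  have hcount := Finset.card_le_card_of_injOn (s := Finset.univ.sigma S)
    (t := Finset.univ ×ˢ Q.roots.toFinset) ψ ?_ ?_
  · rw [Finset.card_sigma, Finset.card_product] at hcount
    simp only [hcard, Finset.sum_const, Finset.card_univ, ZMod.card, Fintype.card_bool,
      smul_eq_mul] at hcount
    have h1 : #Q.roots.toFinset ≤ m :=
      (Multiset.toFinset_card_le _).trans ((Q.card_roots').trans hQdeg)
    have := T.hq
    nlinarith
  · rintro ⟨i, t⟩ hit
    have ht : t ∈ S i := (Finset.mem_sigma.1 hit).2
    have hzero := (hS i t ht).2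
    rw [hfactor i t ht, evalP_smul hh] at hzero
    have hroot := (mul_eq_zero.1 hzero).resolve_left (pow_ne_zero _ (hβ i t ht))
    rw [← eval_lineRestrict] at hroot
    simp only [Finset.coe_product, Set.mem_prod, Finset.coe_univ, Set.mem_univ, true_and,
      Finset.mem_coe, Multiset.mem_toFinset, mem_roots hQ0]
    exact hroot
  · rintro ⟨i, t⟩ hit ⟨i', t'⟩ hit' heq
    have ht : t ∈ S i := (Finset.mem_sigma.1 hit).2
    have ht' : t' ∈ S i' := (Finset.mem_sigma.1 hit').2
    obtain ⟨hsign, hratio⟩ := Prod.ext_iff.1 heq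
    simp only [ψ, decide_eq_decide] at hsign hratio
    have hb := hβ i t ht
    have hb' := hβ i' t' ht'
    have hc : 0 < β (T.edgePoint i' t') / β (T.edgePoint i t) := by
      rcases hb.lt_or_gt with hlt | hgt
      · have : β (T.edgePoint i' t') < 0 :=
          lt_of_le_of_ne (not_lt.1 fun h' => (hsign.2 h').not_gt hlt) hb'
        exact div_pos_of_neg_of_neg this hlt
      · exact div_pos (hsign.1 hgt) hgt
    have hsmul : T.edgePoint i' t' =
        (β (T.edgePoint i' t') / β (T.edgePoint i t)) • T.edgePoint i t := by
      calc T.edgePoint i' t' = β (T.edgePoint i' t') •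
            (p₀ + (γ (T.edgePoint i' t') / β (T.edgePoint i' t')) • p₁) := hfactor i' t' ht'
        _ = (β (T.edgePoint i' t') / β (T.edgePoint i t)) • (β (T.edgePoint i t) •
            (p₀ + (γ (T.edgePoint i t) / β (T.edgePoint i t)) • p₁)) := by
          rw [smul_smul, div_mul_cancel₀ _ hb, hratio]
        _ = _ := congrArg _ (hfactor i t ht).symm
    obtain ⟨rfl, rfl⟩ := T.edgePoint_eq_smul (hS i t ht).1 (hS i' t' ht').1 hc hsmul
    rfl

/-- A linear form whose values at consecutive vertices of a patch have constant sum vanishes. -/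
lemma TrianglePatch.linear_eq_zero (T : TrianglePatch q) {l : MvPolynomial (Fin 2) ℝ}
    (hl : l.IsHomogeneous 1) (c : ℝ)
    (hc : ∀ i, evalP l (T.A (i - 1) - T.z) + evalP l (T.A i - T.z) = c) : l = 0 := by
  have hqz := T.neZero
  set f : ZMod q → ℝ := fun i => evalP l (T.A i - T.z) with hf
  have hsum : ∀ i, f (i - 1) + f i = c := hc
  have hprod : ∀ i, f (i - 1) * f i = f (0 - 1) * f 0 := by
    intro i
    obtain ⟨k, rfl⟩ := ZMod.natCast_zmod_surjective i
    induction k with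
    | zero => simp
    | succ k ih =>
      rw [← ih]
      have h1 := hsum k
      have h2 := hsum ((k + 1 : ℕ) : ZMod q)
      rw [Nat.cast_succ, add_sub_cancel_right] at h2 ⊢
      have h3 : f ((k : ZMod q) + 1) = f ((k : ZMod q) - 1) := by linarith
      rw [h3, mul_comm]
  rcases lt_or_ge (f (0 - 1) * f 0) 0 with hneg | hnonneg
  · refine T.eq_zero_of_roots le_rfl hl (fun i => {f (i - 1) / (f (i - 1) - f i)}) (by simp) ?_
    intro i t ht
    rw [Finset.mem_singleton] at ht
    have hi := hprod i
    rw [← hi] at hneg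
    have hne : f (i - 1) - f i ≠ 0 := by
      intro h0
      rw [sub_eq_zero.1 h0] at hneg
      exact (mul_self_nonneg _).not_gt hneg
    have hd : 1 - t = -f i / (f (i - 1) - f i) := by
      rw [ht, eq_div_iff hne, sub_mul, div_mul_cancel₀ _ hne]
      ring
    refine ⟨?_, ?_⟩
    · rcases mul_neg_iff.1 hneg with ⟨h1, h2⟩ | ⟨h1, h2⟩
      · have ht0 : 0 < t := ht ▸ div_pos h1 (by linarith)
        have ht1 : 0 < 1 - t := hd ▸ div_pos (by linarith) (by linarith)
        exact ⟨ht0, by linarith⟩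
      · have ht0 : 0 < t := ht ▸ div_pos_of_neg_of_neg h1 (by linarith)
        have ht1 : 0 < 1 - t := hd ▸ div_pos_of_neg_of_neg (by linarith) (by linarith)
        exact ⟨ht0, by linarith⟩
    · rw [T.edgePoint_eq, evalP_linear hl, hd, ht]
      change -f i / (f (i - 1) - f i) * f (i - 1) + f (i - 1) / (f (i - 1) - f i) * f i = 0
      ring
  · have hsign : ∀ i, 0 ≤ f (i - 1) * c ∧ 0 ≤ f i * c := by
      intro i
      have h1 := hsum i
      have h2 := hprod i
      constructor <;> rw [← h1] <;>
        nlinarith [mul_self_nonneg (f (i - 1)), mul_self_nonneg (f i)]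
    obtain ⟨ε, hε, hball⟩ := T.covers
    have hcover : ∀ y : ℝ × ℝ, ‖y‖ < ε → ∃ i, ∃ α β : ℝ, 0 ≤ α ∧ 0 ≤ β ∧
        evalP l y = α * f (i - 1) + β * f i := by
      intro y hy
      have hmem : T.z + y ∈ Metric.ball T.z ε := by simpa [mem_ball_iff_norm] using hy
      obtain ⟨i, hi⟩ := Set.mem_iUnion.1 (hball hmem)
      obtain ⟨α, β, hα, hβ, heq⟩ := exists_nonneg_of_mem_closure_tri (T.indep i) hi
      rw [add_assoc] at heq
      exact ⟨i, α, β, hα, hβ, by rw [add_left_cancel heq, evalP_linear hl]⟩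
    refine eq_zero_of_forall_evalP fun y => ?_
    have hy1 : 0 < ‖y‖ + 1 := by positivity
    set r := ε / (‖y‖ + 1) with hr
    have hr0 : 0 < r := div_pos hε hy1
    have hnorm : ‖r • y‖ < ε := by
      rw [norm_smul, Real.norm_of_nonneg hr0.le, hr, div_mul_eq_mul_div, div_lt_iff₀ hy1]
      nlinarith
    have hzero : evalP l (r • y) = 0 := by
      by_cases hc0 : c = 0
      · obtain ⟨i, α, β, -, -, heq⟩ := hcover _ hnorm
        have h1 := hsum i
        have h2 := hprod i
        have hfi : f (i - 1) = 0 := by nlinarith [mul_self_nonneg (f (i - 1))]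
        have hfi' : f i = 0 := by linarith
        rw [heq, hfi, hfi']
        simp
      · have hsg : ∀ y : ℝ × ℝ, ‖y‖ < ε → 0 ≤ evalP l y * c := by
          intro y hy
          obtain ⟨i, α, β, hα, hβ, heq⟩ := hcover y hy
          have := hsign i
          rw [heq, add_mul, mul_assoc, mul_assoc]
          exact add_nonneg (mul_nonneg hα this.1) (mul_nonneg hβ this.2)
        have h1 := hsg _ hnorm
        have h2 := hsg ((-1 : ℝ) • (r • y)) (by rwa [neg_one_smul, norm_neg])
        rw [evalP_smul hl] at h2
        have h3 : evalP l (r • y) * c = 0 := by linarith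
        exact (mul_eq_zero.1 h3).resolve_right hc0
    rw [evalP_smul hl, pow_one] at hzero
    exact (mul_eq_zero.1 hzero).resolve_left hr0.ne'

lemma TrianglePatch.innerT_eq_zero (T : TrianglePatch q) {n : ℕ} {u : MvPolynomial (Fin 2) ℝ}
    (horth : ∀ w : ZMod q → MvPolynomial (Fin 2) ℝ,
      (∀ i : ZMod q, (w i).totalDegree ≤ n - 1) → patchInner T (fun _ => u) w = 0)
    (i : ZMod q) {w : MvPolynomial (Fin 2) ℝ} (hw : w.totalDegree ≤ n - 1) :
    innerT T.z (T.A (i - 1)) (T.A i) u w = 0 := by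
  have hqz := T.neZero
  have h := horth (Pi.single i w) fun j => by
    rcases eq_or_ne j i with rfl | hj
    · simpa using hw
    · simp [Pi.single_eq_of_ne hj]
  rw [patchInner, Finset.sum_eq_single i] at h
  · simpa using h
  · intro j _ hj
    simp [Pi.single_eq_of_ne hj, innerT, evalP]
  · simp

lemma TrianglePatch.sum_radialMoment_mul_edgeMoment (T : TrianglePatch q) {n : ℕ}
    {u : MvPolynomial (Fin 2) ℝ} (hu : u.totalDegree ≤ n)
    (horth : ∀ w : ZMod q → MvPolynomial (Fin 2) ℝ,
      (∀ i : ZMod q, (w i).totalDegree ≤ n - 1) → patchInner T (fun _ => u) w = 0)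
    (i : ZMod q) {v : ℝ[X]} {j : ℕ} (hv : v.natDegree ≤ j) (hj : j < n) :
    ∑ k ∈ range (n + 1), radialMoment (k + j) * edgeMoment T.z (T.A (i - 1)) (T.A i) u v k = 0 := by
  have hD := det2_ne_zero_of_affineIndependent (T.indep i)
  obtain ⟨w, hwdeg, hw⟩ := exists_evalP_duffy T.z hD v j hv
  have h := T.innerT_eq_zero horth i (hwdeg.trans (by omega))
  rw [innerT_eq_sum (T.indep i) hu hw] at h
  exact (mul_eq_zero.1 h).resolve_left (abs_ne_zero.2 hD)

lemma evalP_eq_of_isHomogeneous_zero {h : MvPolynomial (Fin 2) ℝ} (hh : h.IsHomogeneous 0)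
    (x : ℝ × ℝ) : evalP h x = evalP h 0 := by
  simpa using (evalP_smul hh 0 x).symm

lemma unitIntegral_X_pow (k : ℕ) : unitIntegral (X ^ k) = 1 / (k + 1) := by
  simp [unitIntegral_apply, integral_pow]

lemma edgeMoment_zero (z A B : ℝ × ℝ) (u : MvPolynomial (Fin 2) ℝ) :
    edgeMoment z A B u 1 0 = evalP (componentAt z u 0) 0 / 6 := by
  have h : lineRestrict (A - z) (B - A) (componentAt z u 0) =
      C (evalP (componentAt z u 0) 0) := Polynomial.funext fun t => by
    rw [eval_lineRestrict, evalP_eq_of_isHomogeneous_zero (componentAt_isHomogeneous z u 0), eval_C]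
  have hexp : C (evalP (componentAt z u 0) 0) * 1 * (X * (1 - X)) =
      evalP (componentAt z u 0) 0 • (X ^ 1 - X ^ 2) := by
    rw [smul_eq_C_mul]; ring
  rw [edgeMoment, h, hexp, map_smul, map_sub, unitIntegral_X_pow, unitIntegral_X_pow, smul_eq_mul]
  push_cast
  ring

lemma edgeMoment_one (z A B : ℝ × ℝ) (u : MvPolynomial (Fin 2) ℝ) :
    edgeMoment z A B u 1 1 =
      (evalP (componentAt z u 1) (A - z) + evalP (componentAt z u 1) (B - z)) / 12 := by
  have h : lineRestrict (A - z) (B - A) (componentAt z u 1) =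
      C (evalP (componentAt z u 1) (A - z)) * (1 - X) +
      C (evalP (componentAt z u 1) (B - z)) * X := Polynomial.funext fun t => by
    have hp : (A - z) + t • (B - A) = (1 - t) • (A - z) + t • (B - z) := by module
    rw [eval_lineRestrict, hp, evalP_linear (componentAt_isHomogeneous z u 1)]
    simp
    ring
  have hexp : (C (evalP (componentAt z u 1) (A - z)) * (1 - X) +
      C (evalP (componentAt z u 1) (B - z)) * X) * 1 * (X * (1 - X)) =
      evalP (componentAt z u 1) (A - z) • (X ^ 1 - (2 : ℝ) • X ^ 2 + X ^ 3) +
      evalP (componentAt z u 1) (B - z) • (X ^ 2 - X ^ 3) := by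
    simp only [smul_eq_C_mul, C_ofNat]
    ring
  rw [edgeMoment, h, hexp]
  simp only [map_add, map_smul, map_sub, unitIntegral_X_pow, smul_eq_mul]
  push_cast
  ring

lemma edgeMoment_eq_zero {z : ℝ × ℝ} {u : MvPolynomial (Fin 2) ℝ} {k : ℕ}
    (h : componentAt z u k = 0) (A B : ℝ × ℝ) (v : ℝ[X]) : edgeMoment z A B u v k = 0 := by
  simp [edgeMoment, h, lineRestrict]

lemma TrianglePatch.componentAt_zero_and_one_eq_zero (T : TrianglePatch q) {n : ℕ} (hn : 1 ≤ n)
    {u : MvPolynomial (Fin 2) ℝ} (hu : u.totalDegree ≤ n)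
    (horth : ∀ w : ZMod q → MvPolynomial (Fin 2) ℝ,
      (∀ i : ZMod q, (w i).totalDegree ≤ n - 1) → patchInner T (fun _ => u) w = 0) :
    componentAt T.z u 0 = 0 ∧ componentAt T.z u 1 = 0 := by
  set b : ZMod q → ℕ → ℝ := fun i k => edgeMoment T.z (T.A (i - 1)) (T.A i) u 1 k with hb
  have hsum : ∀ i, ∀ j < n, ∑ k ∈ range (n + 1), radialMoment (k + j) * b i k = 0 :=
    fun i j hj => T.sum_radialMoment_mul_edgeMoment hu horth i (by simp) hj
  have hone : componentAt T.z u 1 = 0 := by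
    refine T.linear_eq_zero (componentAt_isHomogeneous _ _ _) (12 * b 0 1) fun i => ?_
    have hdiff := eq_zero_of_sum_radialMoment le_rfl (n := n) (fun k => b i k - b 0 k)
      (fun k hk => by
        obtain rfl : k = 0 := by omega
        simp only [hb, edgeMoment_zero, sub_self])
      (fun j _ hj => by
        simp only [mul_sub, Finset.sum_sub_distrib, hsum i j hj, hsum 0 j hj, sub_zero]) 1 hn
    have hi : b i 1 = (evalP (componentAt T.z u 1) (T.A (i - 1) - T.z) +
        evalP (componentAt T.z u 1) (T.A i - T.z)) / 12 := edgeMoment_one _ _ _ _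
    linarith
  refine ⟨?_, hone⟩
  have hzero := coeff_zero_eq_zero_of_sum_radialMoment hn (b 0) (edgeMoment_eq_zero hone _ _ _)
    (hsum 0)
  simp only [hb, edgeMoment_zero] at hzero
  refine eq_zero_of_forall_evalP fun x => ?_
  rw [evalP_eq_of_isHomogeneous_zero (componentAt_isHomogeneous _ _ _)]
  linarith

lemma TrianglePatch.componentAt_eq_zero (T : TrianglePatch q) {n : ℕ} (hn : 1 ≤ n)
    {u : MvPolynomial (Fin 2) ℝ} (hu : u.totalDegree ≤ n)
    (horth : ∀ w : ZMod q → MvPolynomial (Fin 2) ℝ,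
      (∀ i : ZMod q, (w i).totalDegree ≤ n - 1) → patchInner T (fun _ => u) w = 0)
    (m : ℕ) (hmn : m ≤ n) : componentAt T.z u m = 0 := by
  induction m using Nat.strong_induction_on with
  | _ m ih =>
    rcases Nat.eq_zero_or_pos m with rfl | hm
    · exact (T.componentAt_zero_and_one_eq_zero hn hu horth).1
    have hroots : ∀ i, ∃ S : Finset ℝ, #S = m ∧ ∀ t ∈ S, t ∈ Set.Ioo (0 : ℝ) 1 ∧
        evalP (componentAt T.z u m) (T.edgePoint i t) = 0 := by
      intro i
      simp only [edgePoint, ← eval_lineRestrict]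
      refine exists_roots_of_orthogonal m _ (X * (1 - X)) (fun x hx => ?_) fun v hv => ?_
      · simpa using mul_pos hx.1 (sub_pos.2 hx.2)
      · exact eq_zero_of_sum_radialMoment hm
          (fun k => edgeMoment T.z (T.A (i - 1)) (T.A i) u v k)
          (fun k hk => edgeMoment_eq_zero (ih k hk (by omega)) _ _ _)
          (fun j hj hjn => T.sum_radialMoment_mul_edgeMoment hu horth i (by omega) hjn) m hmn
    choose S hcard hS using hroots
    exact T.eq_zero_of_roots hm (componentAt_isHomogeneous _ _ _) S hcard hS

end Patches

/-- Let `n ≥ 1` and let `𝒯` be a triangle patch around `z ∈ ℝ²`.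
If `u` is a bivariate polynomial of total degree at most `n` with `(u,w)_𝒯 = 0` for every
piecewise polynomial `w` with `w|_{K_i} ∈ P_{n-1}(K_i)` for every `i`, then `u = 0` on `Ω`. -/
theorem statement1 (n q : ℕ) (hn : 1 ≤ n) (T : TrianglePatch q)
    (u : MvPolynomial (Fin 2) ℝ) (hu : u.totalDegree ≤ n)
    (horth : ∀ w : ZMod q → MvPolynomial (Fin 2) ℝ,
      (∀ i : ZMod q, (w i).totalDegree ≤ n - 1) → patchInner T (fun _ => u) w = 0) :
    ∀ p ∈ T.Omega, evalP u p = 0 := by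
  intro p _
  have hp : p = T.z + (1 : ℝ) • (p - T.z) := by simp
  rw [hp, evalP_add_smul hu]
  refine Finset.sum_eq_zero fun k hk => ?_
  rw [T.componentAt_eq_zero hn hu horth k (Nat.lt_succ_iff.1 (Finset.mem_range.1 hk))]
  simp [evalP]
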